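/- (Index-49 example) For every τ ∈ ℍ and z ∈ ℂ, writing ϑ_j for ϑ(τ,jz) (and ϑ for ϑ(τ,z)), one has η(τ)^{−3}·ϑ⁴ϑ₂ϑ₃ϑ₄²ϑ₇ = η(τ)^{−3}·ϑ³ϑ₂³ϑ₃ϑ₅ϑ₇ − η(τ)^{−3}·ϑ⁵ϑ₂²ϑ₆ϑ₇. -/

import Mathlib

open Complex

/-- The odd Jacobi theta function
`ϑ(τ,z) = e^{πiτ/4}(e^{πiz} − e^{−πiz}) ∏_{n≥1} (1−qⁿe^{2πiz})(1−qⁿe^{−2πiz})(1−qⁿ)`,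
where `q = e^{2πiτ}`. -/
noncomputable def jTheta (τ z : ℂ) : ℂ :=
  Complex.exp (Real.pi * Complex.I * τ / 4) *
    (Complex.exp (Real.pi * Complex.I * z) - Complex.exp (-(Real.pi * Complex.I * z))) *
    ∏' n : ℕ,
      ((1 - Complex.exp (2 * Real.pi * Complex.I * τ) ^ (n + 1) *
            Complex.exp (2 * Real.pi * Complex.I * z)) *
       (1 - Complex.exp (2 * Real.pi * Complex.I * τ) ^ (n + 1) *
            Complex.exp (-(2 * Real.pi * Complex.I * z))) *
       (1 - Complex.exp (2 * Real.pi * Complex.I * τ) ^ (n + 1)))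

/-- The Dedekind eta function `η(τ) = e^{πiτ/12} ∏_{n≥1} (1 − e^{2πinτ})`. -/
noncomputable def dedekindEta (τ : ℂ) : ℂ :=
  Complex.exp (Real.pi * Complex.I * τ / 12) *
    ∏' n : ℕ, (1 - Complex.exp (2 * Real.pi * Complex.I * (n + 1) * τ))

section helpers

open Filter Topology

theorem aux_congr {ι : Type} {f g : ι → ℂ} {a : ℂ} (h : HasSum f a) (hfg : ∀ i, g i = f i) :
    HasSum g a := by
  rwa [funext hfg]

theorem aux_congr2 {ι : Type} {f g : ι → ℂ} {a b : ℂ} (h : HasSum f a) (hfg : ∀ i, g i = f i)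
    (hab : b = a) : HasSum g b := by
  rwa [funext hfg, hab]

theorem aux_summable (z : ℂ) {τ : ℂ} (hτ : 0 < τ.im) :
    Summable (fun n : ℤ => ‖jacobiTheta₂_term n z τ‖) :=
  ((summable_jacobiTheta₂_term_iff z τ).mpr hτ).norm

theorem aux_prod (s t : ℂ) {τ : ℂ} (hτ : 0 < τ.im) :
    HasSum (fun p : ℤ × ℤ => jacobiTheta₂_term p.1 s τ * jacobiTheta₂_term p.2 t τ)
      (jacobiTheta₂ s τ * jacobiTheta₂ t τ) := by
  have h := (summable_mul_of_summable_norm (aux_summable s hτ) (aux_summable t hτ)).hasSum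
  rw [← tsum_mul_tsum_of_summable_norm (aux_summable s hτ) (aux_summable t hτ)] at h
  exact h

theorem theta_add (s t : ℂ) {τ : ℂ} (hτ : 0 < τ.im) :
    jacobiTheta₂ s τ * jacobiTheta₂ t τ =
      jacobiTheta₂ (s + t) (2 * τ) * jacobiTheta₂ (s - t) (2 * τ) +
      Complex.exp (Real.pi * I * τ + 2 * Real.pi * I * s) *
        (jacobiTheta₂ (s + t + τ) (2 * τ) * jacobiTheta₂ (s - t + τ) (2 * τ)) := by
  have hτ2 : 0 < (2 * τ).im := by simpa using hτ
  set F : ℤ × ℤ → ℂ := fun p => jacobiTheta₂_term p.1 s τ * jacobiTheta₂_term p.2 t τ with hF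
  let e : ℤ × ℤ → ℤ × ℤ := fun p => (p.1 + p.2, p.1 - p.2)
  let o : ℤ × ℤ → ℤ × ℤ := fun p => (p.1 + p.2 + 1, p.1 - p.2)
  have he : Function.Injective e := by
    rintro ⟨a, b⟩ ⟨c, d⟩ h
    simp only [e, Prod.mk.injEq] at h ⊢
    omega
  have ho : Function.Injective o := by
    rintro ⟨a, b⟩ ⟨c, d⟩ h
    simp only [o, Prod.mk.injEq] at h ⊢
    omega
  have hc : IsCompl (Set.range e) (Set.range o) := by
    constructor
    · rw [Set.disjoint_left]
      rintro _ ⟨⟨a, b⟩, rfl⟩ ⟨⟨c, d⟩, h⟩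
      simp only [e, o, Prod.mk.injEq] at h
      omega
    · rw [codisjoint_iff_le_sup]
      rintro ⟨a, b⟩ -
      rcases Int.even_or_odd' (a + b) with ⟨k, hk | hk⟩
      · left
        refine ⟨(k, a - k), ?_⟩
        simp only [e, Prod.mk.injEq]
        omega
      · right
        refine ⟨(k, a - k - 1), ?_⟩
        simp only [o, Prod.mk.injEq]
        omega
  have h1 : HasSum (F ∘ e) (jacobiTheta₂ (s + t) (2 * τ) * jacobiTheta₂ (s - t) (2 * τ)) := by
    convert aux_prod (s + t) (s - t) hτ2 using 1
    funext p
    simp only [hF, e, Function.comp, jacobiTheta₂_term, ← Complex.exp_add]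
    push_cast
    ring_nf
  have h2 : HasSum (F ∘ o) (Complex.exp (Real.pi * I * τ + 2 * Real.pi * I * s) *
        (jacobiTheta₂ (s + t + τ) (2 * τ) * jacobiTheta₂ (s - t + τ) (2 * τ))) := by
    refine aux_congr ((aux_prod (s + t + τ) (s - t + τ) hτ2).mul_left
      (Complex.exp (Real.pi * I * τ + 2 * Real.pi * I * s))) ?_
    intro p
    simp only [hF, o, Function.comp, jacobiTheta₂_term, ← Complex.exp_add]
    push_cast
    ring_nf
  have h1' := he.hasSum_range_iff.mpr h1
  have h2' := ho.hasSum_range_iff.mpr h2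
  exact (aux_prod s t hτ).unique (h1'.add_isCompl hc h2')

/-- finite `q`-Pochhammer symbol -/
noncomputable def qP (q : ℂ) (n : ℕ) : ℂ := ∏ i ∈ Finset.range n, (1 - q ^ (i + 1))

/-- reciprocal of `qP`, extended by zero to negative integers -/
noncomputable def qR (q : ℂ) (k : ℤ) : ℂ := if k < 0 then 0 else (qP q k.toNat)⁻¹

theorem one_sub_ne {q : ℂ} (hq : ‖q‖ < 1) (n : ℕ) : 1 - q ^ (n + 1) ≠ 0 := by
  intro h
  have h1 : q ^ (n + 1) = 1 := by linear_combination -h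
  have h2 : ‖q‖ ^ (n + 1) = 1 := by rw [← norm_pow, h1, norm_one]
  have := pow_lt_one₀ (norm_nonneg q) hq (Nat.succ_ne_zero n)
  simp only [Nat.succ_eq_add_one] at this
  linarith

theorem qP_ne {q : ℂ} (hq : ‖q‖ < 1) (n : ℕ) : qP q n ≠ 0 :=
  Finset.prod_ne_zero_iff.mpr fun i _ => one_sub_ne hq i

theorem qR_rec {q : ℂ} (hq : ‖q‖ < 1) (k : ℤ) : qR q (k - 1) = (1 - q ^ k) * qR q k := by
  rcases lt_trichotomy k 0 with h | h | h
  · have h' : k - 1 < 0 := by omega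
    simp [qR, h, h']
  · subst h
    simp [qR]
  · obtain ⟨n, rfl⟩ : ∃ n : ℕ, k = n + 1 := ⟨(k - 1).toNat, by omega⟩
    have h1 : ¬ ((n : ℤ) + 1 < 0) := by omega
    have h2 : ((n : ℤ) + 1).toNat = n + 1 := by omega
    have h3 : ((n : ℤ) + 1 - 1) = n := by omega
    have h4 : ¬ ((n : ℤ) < 0) := by omega
    rw [h3, qR, qR, if_neg h1, if_neg h4, h2, Int.toNat_natCast]
    have h5 : q ^ ((n : ℤ) + 1) = q ^ (n + 1) := by exact_mod_cast zpow_natCast q (n + 1)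
    have h6 : qP q (n + 1) = qP q n * (1 - q ^ (n + 1)) := by
      rw [qP, qP, Finset.prod_range_succ]
    rw [h5, h6]
    have := one_sub_ne hq n
    have := qP_ne hq n
    field_simp

theorem finite_jtp {q u : ℂ} (hq : ‖q‖ < 1) (hq0 : q ≠ 0) (hu : u ≠ 0) (T : ℤ → ℂ)
    (hT0 : T 0 = 1) (hT : ∀ j, T (j + 1) = - q ^ j * u * T j) (n : ℕ) :
    HasSum (fun j : ℤ => qP q (2 * n) * qR q (n + j) * qR q (n - j) * T j)
      (∏ m ∈ Finset.range n, ((1 - q ^ m * u) * (1 - q ^ (m + 1) * u⁻¹))) := by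
  induction n with
  | zero =>
    have := hasSum_single (f := fun j : ℤ => qP q (2 * 0) * qR q ((0 : ℕ) + j) *
      qR q ((0 : ℕ) - j) * T j) 0 (by
        intro j hj
        rcases lt_or_gt_of_ne hj with h | h
        · simp [qR, h]
        · simp [qR, h])
    convert this using 1
    simp [qP, qR, hT0]
  | succ n ih =>
    have ihm := (Equiv.addRight (-1 : ℤ)).hasSum_iff.mpr ih
    have ihp := (Equiv.addRight (1 : ℤ)).hasSum_iff.mpr ih
    have h := ((ih.mul_left (1 + q ^ (2 * n + 1))).sub (ihm.mul_left (q ^ n * u))).sub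
      (ihp.mul_left (q ^ (n + 1) * u⁻¹))
    rw [Finset.prod_range_succ]
    refine aux_congr2 h ?_ ?_
    · intro j
      simp only [Function.comp, Equiv.coe_addRight]
      have t1 : T j = - q ^ (j - 1) * u * T (j + -1) := by
        have := hT (j - 1)
        rwa [sub_add_cancel, sub_eq_add_neg j 1] at this
      have t1' : u * T (j + -1) = - (q ^ (j - 1))⁻¹ * T j := by
        have : q ^ (j - 1) ≠ 0 := zpow_ne_zero _ hq0
        rw [t1]
        field_simp
      have t2' : u⁻¹ * T (j + 1) = - q ^ j * T j := by
        rw [hT j]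
        field_simp
      have r1 := qR_rec hq (n + 1 + j)
      have r2 := qR_rec hq (n + 1 - j)
      have r3 := qR_rec hq (n + j)
      have r4 := qR_rec hq (n - j)
      have e1 : (n : ℤ) + 1 + j - 1 = n + j := by ring
      have e2 : (n : ℤ) + 1 - j - 1 = n - j := by ring
      rw [e1] at r1
      rw [e2] at r2
      rw [r1] at r3
      rw [r2] at r4
      have e3 : (n : ℤ) + (j + -1) = n + j - 1 := by ring
      have e4 : (n : ℤ) - (j + -1) = n + 1 - j := by ring
      have e5 : (n : ℤ) + (j + 1) = n + 1 + j := by ring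
      have e6 : (n : ℤ) - (j + 1) = n - j - 1 := by ring
      have e7 : ((n + 1 : ℕ) : ℤ) + j = n + 1 + j := by push_cast; ring
      have e8 : ((n + 1 : ℕ) : ℤ) - j = n + 1 - j := by push_cast; ring
      rw [e3, e4, e5, e6, e7, e8, r1, r2, r3, r4]
      have hP : qP q (2 * (n + 1)) = qP q (2 * n) * (1 - q ^ (2 * n + 1)) *
          (1 - q ^ (2 * n + 2)) := by
        rw [show 2 * (n + 1) = 2 * n + 1 + 1 by ring, qP, Finset.prod_range_succ,
          Finset.prod_range_succ, qP]
      rw [hP]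
      generalize qR q (n + 1 + j) = A
      generalize qR q (n + 1 - j) = B
      have z1 : q ^ ((n : ℤ) + 1 + j) = q ^ n * q * q ^ j := by
        rw [zpow_add₀ hq0, zpow_add₀ hq0, zpow_natCast, zpow_one]
      have z2 : q ^ ((n : ℤ) + 1 - j) = q ^ n * q * (q ^ j)⁻¹ := by
        rw [zpow_sub₀ hq0, zpow_add₀ hq0, zpow_natCast, zpow_one]; rfl
      have z3 : q ^ ((n : ℤ) + j) = q ^ n * q ^ j := by
        rw [zpow_add₀ hq0, zpow_natCast]
      have z4 : q ^ ((n : ℤ) - j) = q ^ n * (q ^ j)⁻¹ := by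
        rw [zpow_sub₀ hq0, zpow_natCast]; rfl
      have z5 : q ^ (j - 1) = q ^ j * q⁻¹ := by
        rw [zpow_sub₀ hq0, zpow_one]; rfl
      rw [z5] at t1'
      rw [z1, z2, z3, z4]
      have hx : q ^ j ≠ 0 := zpow_ne_zero _ hq0
      generalize q ^ j = x at *
      generalize qP q (2 * n) = P
      have s1 : ∀ a b c : ℂ, q ^ n * u * (P * a * b * T (j + -1)) =
          q ^ n * P * a * b * (u * T (j + -1)) := by intros; ring
      have s2 : ∀ a b c : ℂ, q ^ (n + 1) * u⁻¹ * (P * a * b * T (j + 1)) =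
          q ^ (n + 1) * P * a * b * (u⁻¹ * T (j + 1)) := by intros; ring
      rw [s1 _ _ 0, s2 _ _ 0, t1', t2']
      have p1 : q ^ (2 * n + 1) = (q ^ n) ^ 2 * q := by ring
      have p2 : q ^ (2 * n + 2) = (q ^ n) ^ 2 * q ^ 2 := by ring
      have p3 : q ^ (n + 1) = q ^ n * q := by ring
      rw [p1, p2, p3]
      generalize q ^ n = y
      field_simp
      ring
    · generalize (∏ x ∈ Finset.range n, (1 - q ^ x * u) * (1 - q ^ (x + 1) * u⁻¹)) = W
      field_simp
      ring

theorem qP_tendsto {q : ℂ} (hq : ‖q‖ < 1) :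
    ∃ L : ℂ, L ≠ 0 ∧ Tendsto (qP q) atTop (𝓝 L) := by
  have hs : Summable (fun n : ℕ => ‖-q ^ (n + 1)‖) := by
    simp only [norm_neg, norm_pow]
    exact (summable_nat_add_iff 1).mpr (summable_geometric_of_lt_one (norm_nonneg q) hq)
  refine ⟨∏' n : ℕ, (1 + -q ^ (n + 1)), tprod_one_add_ne_zero_of_summable ?_ hs, ?_⟩
  · intro i
    simpa [← sub_eq_add_neg] using one_sub_ne hq i
  · have := (multipliable_one_add_of_summable hs).tendsto_prod_tprod_nat
    simpa [funext_iff, ← sub_eq_add_neg, show qP q = fun n => ∏ i ∈ Finset.range n, (1 - q ^ (i + 1)) from rfl] using this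

theorem jtp {q u : ℂ} (hq : ‖q‖ < 1) (hq0 : q ≠ 0) (hu : u ≠ 0) (T : ℤ → ℂ)
    (hT0 : T 0 = 1) (hT : ∀ j, T (j + 1) = - q ^ j * u * T j) (hTs : Summable fun j => ‖T j‖) :
    (1 - u) * ∏' n : ℕ, ((1 - q ^ (n + 1) * u) * (1 - q ^ (n + 1) * u⁻¹) * (1 - q ^ (n + 1))) =
      ∑' j, T j := by
  obtain ⟨L, hL, hPL⟩ := qP_tendsto hq
  have hRL : Tendsto (fun n : ℕ => (qP q n)⁻¹) atTop (𝓝 L⁻¹) := hPL.inv₀ hL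
  obtain ⟨C, hC⟩ := (Metric.isBounded_range_of_tendsto _ hPL).exists_norm_le
  obtain ⟨D, hD⟩ := (Metric.isBounded_range_of_tendsto _ hRL).exists_norm_le
  have hC' : ∀ n, ‖qP q n‖ ≤ C := fun n => hC _ ⟨n, rfl⟩
  have hD0 : 0 ≤ D := (norm_nonneg _).trans (hD _ ⟨0, rfl⟩)
  have hC0 : 0 ≤ C := (norm_nonneg _).trans (hC' 0)
  have hD' : ∀ k, ‖qR q k‖ ≤ D := by
    intro k
    unfold qR
    split_ifs
    · simpa using hD0
    · exact hD _ ⟨k.toNat, rfl⟩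
  have hRZ : Tendsto (qR q) atTop (𝓝 L⁻¹) := by
    have h1 : Tendsto (fun k : ℤ => (qP q k.toNat)⁻¹) atTop (𝓝 L⁻¹) := by
      refine hRL.comp ?_
      exact tendsto_atTop.mpr fun b => (eventually_ge_atTop (b : ℤ)).mono fun k hk => by omega
    refine h1.congr' ?_
    filter_upwards [eventually_ge_atTop (0 : ℤ)] with k hk
    rw [qR, if_neg (by omega)]
  have hlim := tendsto_tsum_of_dominated_convergence (𝓕 := atTop)
    (f := fun (n : ℕ) (j : ℤ) => qP q (2 * n) * qR q (n + j) * qR q (n - j) * T j)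
    (g := fun j => L * L⁻¹ * L⁻¹ * T j) (bound := fun j => C * D * D * ‖T j‖)
    (hTs.mul_left _) (by
      intro j
      have a1 : Tendsto (fun n : ℕ => 2 * n) atTop atTop :=
        tendsto_id.const_mul_atTop' (by norm_num)
      have a2 : Tendsto (fun n : ℕ => (n : ℤ) + j) atTop atTop :=
        tendsto_atTop_add_const_right _ _ tendsto_natCast_atTop_atTop
      have a3 : Tendsto (fun n : ℕ => (n : ℤ) - j) atTop atTop :=
        tendsto_atTop_add_const_right _ (-j) tendsto_natCast_atTop_atTop
      exact (((hPL.comp a1).mul (hRZ.comp a2)).mul (hRZ.comp a3)).mul_const _) (by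
      refine Eventually.of_forall fun n j => ?_
      simp only [norm_mul]
      gcongr
      · exact hC' _
      · exact hD' _
      · exact hD' _)
  simp only [(finite_jtp hq hq0 hu T hT0 hT _).tsum_eq] at hlim
  rw [tsum_mul_left] at hlim
  have hqs : Summable (fun n : ℕ => ‖q‖ ^ (n + 1)) :=
    (summable_nat_add_iff 1).mpr (summable_geometric_of_lt_one (norm_nonneg q) hq)
  have hmul : ∀ v : ℂ, Multipliable (fun n : ℕ => 1 - q ^ (n + 1) * v) := by
    intro v
    have : Summable (fun n : ℕ => ‖-(q ^ (n + 1) * v)‖) := by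
      simp only [norm_neg, norm_mul, norm_pow]
      exact hqs.mul_right _
    simpa [← sub_eq_add_neg] using multipliable_one_add_of_summable this
  have hm : Multipliable (fun n : ℕ =>
      ((1 - q ^ (n + 1) * u) * (1 - q ^ (n + 1) * u⁻¹) * (1 - q ^ (n + 1)))) := by
    have h1 := hmul 1
    simp only [mul_one] at h1
    exact ((hmul u).mul (hmul u⁻¹)).mul h1
  have hl1 := hm.tendsto_prod_tprod_nat.const_mul (1 - u)
  have hqn : Tendsto (fun n : ℕ => 1 - q ^ n * u) atTop (𝓝 (1 - 0 * u)) :=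
    ((tendsto_pow_atTop_nhds_zero_of_norm_lt_one hq).mul_const u).const_sub 1
  have hl2 := (hlim.mul hPL).mul hqn
  have heq : ∀ n : ℕ, (∏ m ∈ Finset.range n, ((1 - q ^ m * u) * (1 - q ^ (m + 1) * u⁻¹))) *
      qP q n * (1 - q ^ n * u) = (1 - u) * ∏ n ∈ Finset.range n,
        ((1 - q ^ (n + 1) * u) * (1 - q ^ (n + 1) * u⁻¹) * (1 - q ^ (n + 1))) := by
    intro n
    induction n with
    | zero => simp [qP]
    | succ n ih =>
      rw [Finset.prod_range_succ, Finset.prod_range_succ, ← mul_assoc (1 - u), ← ih, qP, qP,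
        Finset.prod_range_succ]
      ring
  simp only [heq] at hl2
  rw [tendsto_nhds_unique hl1 hl2]
  field_simp
  ring

theorem jTheta_eq {τ : ℂ} (hτ : 0 < τ.im) (z : ℂ) :
    jTheta τ z = - Complex.exp (Real.pi * I * τ / 4) * Complex.exp (-(Real.pi * I * z)) *
      jacobiTheta₂ (z + 1 / 2 - τ / 2) τ := by
  have hq : ‖Complex.exp (2 * Real.pi * I * τ)‖ < 1 :=
    UpperHalfPlane.norm_exp_two_pi_I_lt_one ⟨τ, hτ⟩
  have h := jtp hq (Complex.exp_ne_zero _) (Complex.exp_ne_zero (2 * Real.pi * I * z))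
    (fun j => jacobiTheta₂_term j (z + 1 / 2 - τ / 2) τ) (by simp [jacobiTheta₂_term])
    (by
      intro j
      have hneg : ∀ w : ℂ, -w = Complex.exp (Real.pi * I) * w := by
        intro w; rw [Complex.exp_pi_mul_I]; ring
      rw [neg_mul, neg_mul, hneg, ← Complex.exp_int_mul]
      simp only [jacobiTheta₂_term, ← Complex.exp_add]
      push_cast
      ring_nf) (aux_summable _ hτ)
  rw [jacobiTheta₂, ← h, jTheta]
  rw [← Complex.exp_neg (2 * Real.pi * I * z)]
  have h2 : Complex.exp (Real.pi * I * z) =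
      Complex.exp (-(Real.pi * I * z)) * Complex.exp (2 * Real.pi * I * z) := by
    rw [← Complex.exp_add]; ring_nf
  rw [h2]
  ring

theorem jTheta_mul {τ : ℂ} (hτ : 0 < τ.im) (x y : ℂ) :
    jTheta τ (x + y) * jTheta τ (x - y) = Complex.exp (Real.pi * I * τ / 2) *
      ((Complex.exp (2 * Real.pi * I * x) * jacobiTheta₂ (2 * x + τ) (2 * τ)) *
        jacobiTheta₂ (2 * y) (2 * τ) -
       jacobiTheta₂ (2 * x) (2 * τ) *
        (Complex.exp (2 * Real.pi * I * y) * jacobiTheta₂ (2 * y + τ) (2 * τ))) := by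
  rw [jTheta_eq hτ, jTheta_eq hτ]
  have h := theta_add (x + y + 1 / 2 - τ / 2) (x - y + 1 / 2 - τ / 2) hτ
  have e1 : x + y + 1 / 2 - τ / 2 + (x - y + 1 / 2 - τ / 2) = (2 * x - τ) + 1 := by ring
  have e2 : x + y + 1 / 2 - τ / 2 - (x - y + 1 / 2 - τ / 2) = 2 * y := by ring
  have e3 : 2 * x - τ + 1 + τ = 2 * x + 1 := by ring
  rw [e1, e2, e3, jacobiTheta₂_add_left, jacobiTheta₂_add_left] at h
  have h3 := jacobiTheta₂_add_left' (2 * x - τ) (2 * τ)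
  have e4 : 2 * x - τ + 2 * τ = 2 * x + τ := by ring
  rw [e4] at h3
  rw [h3]
  have x1 : Complex.exp (2 * Real.pi * I * x) *
      Complex.exp (-Real.pi * I * (2 * τ + 2 * (2 * x - τ))) =
      Complex.exp (-(2 * Real.pi * I * x)) := by
    rw [← Complex.exp_add]; ring_nf
  have x2 : Complex.exp (Real.pi * I * τ + 2 * Real.pi * I * (x + y + 1 / 2 - τ / 2)) =
      - (Complex.exp (2 * Real.pi * I * x) * Complex.exp (2 * Real.pi * I * y)) := by
    have : ∀ w : ℂ, -w = Complex.exp (Real.pi * I) * w := by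
      intro w; rw [Complex.exp_pi_mul_I]; ring
    rw [this, ← Complex.exp_add, ← Complex.exp_add]; ring_nf
  have x3 : Complex.exp (-(Real.pi * I * (x + y))) * Complex.exp (-(Real.pi * I * (x - y))) =
      Complex.exp (-(2 * Real.pi * I * x)) := by
    rw [← Complex.exp_add]; ring_nf
  have x4 : Complex.exp (Real.pi * I * τ / 2) = Complex.exp (Real.pi * I * τ / 4) *
      Complex.exp (Real.pi * I * τ / 4) := by
    rw [← Complex.exp_add]; ring_nf
  have x5 : Complex.exp (-(2 * Real.pi * I * x)) * Complex.exp (2 * Real.pi * I * x) = 1 := by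
    rw [← Complex.exp_add]; simp
  rw [x2] at h
  rw [← mul_assoc (Complex.exp (2 * Real.pi * I * x)), x1, x4]
  generalize Complex.exp (Real.pi * I * τ / 4) = c at *
  generalize Complex.exp (-(2 * Real.pi * I * x)) = X' at *
  generalize Complex.exp (2 * Real.pi * I * x) = X at *
  generalize Complex.exp (2 * Real.pi * I * y) = Y at *
  generalize Complex.exp (-(Real.pi * I * (x + y))) = U at *
  generalize Complex.exp (-(Real.pi * I * (x - y))) = V at *
  generalize jacobiTheta₂ (x + y + 1 / 2 - τ / 2) τ = A at *
  generalize jacobiTheta₂ (x - y + 1 / 2 - τ / 2) τ = B at *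
  generalize jacobiTheta₂ (2 * x - τ) (2 * τ) = t1 at *
  generalize jacobiTheta₂ (2 * x) (2 * τ) = t2 at *
  generalize jacobiTheta₂ (2 * y) (2 * τ) = t3 at *
  generalize jacobiTheta₂ (2 * y + τ) (2 * τ) = t4 at *
  linear_combination c * c * A * B * x3 + c * c * X' * h - c * c * Y * t2 * t4 * x5

theorem three_term {τ : ℂ} (hτ : 0 < τ.im) (z : ℂ) :
    jTheta τ z * jTheta τ (3 * z) * jTheta τ (4 * z) ^ 2 =
      jTheta τ (2 * z) ^ 2 * jTheta τ (3 * z) * jTheta τ (5 * z) -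
      jTheta τ z ^ 2 * jTheta τ (2 * z) * jTheta τ (6 * z) := by
  have h40 := jTheta_mul hτ (4 * z) 0
  have h21 := jTheta_mul hτ (2 * z) z
  have h42 := jTheta_mul hτ (4 * z) (2 * z)
  have h10 := jTheta_mul hτ z 0
  have h41 := jTheta_mul hτ (4 * z) z
  have h20 := jTheta_mul hτ (2 * z) 0
  rw [show 2 * z + z = 3 * z by ring, show 2 * z - z = z by ring] at h21
  rw [show 4 * z + 2 * z = 6 * z by ring, show 4 * z - 2 * z = 2 * z by ring] at h42
  rw [show 4 * z + z = 5 * z by ring, show 4 * z - z = 3 * z by ring] at h41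
  rw [add_zero, sub_zero] at h40 h10 h20
  have e1 : jTheta τ z * jTheta τ (3 * z) * jTheta τ (4 * z) ^ 2 =
    (jTheta τ (4 * z) * jTheta τ (4 * z)) * (jTheta τ (3 * z) * jTheta τ z) := by ring
  have e2 : jTheta τ (2 * z) ^ 2 * jTheta τ (3 * z) * jTheta τ (5 * z) =
    (jTheta τ (2 * z) * jTheta τ (2 * z)) * (jTheta τ (5 * z) * jTheta τ (3 * z)) := by ring
  have e3 : jTheta τ z ^ 2 * jTheta τ (2 * z) * jTheta τ (6 * z) =
    (jTheta τ z * jTheta τ z) * (jTheta τ (6 * z) * jTheta τ (2 * z)) := by ring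
  rw [e1, e2, e3, h40, h21, h42, h10, h41, h20]
  ring

end helpers

/-- Index-49 example:
`η⁻³ ϑ⁴ϑ₂ϑ₃ϑ₄²ϑ₇ = η⁻³ ϑ³ϑ₂³ϑ₃ϑ₅ϑ₇ − η⁻³ ϑ⁵ϑ₂²ϑ₆ϑ₇`, where `ϑ_j = ϑ(τ, jz)`. -/
theorem index49_example (τ : ℂ) (hτ : 0 < τ.im) (z : ℂ) :
    dedekindEta τ ^ (-3 : ℤ) *
      (jTheta τ z ^ 4 * jTheta τ (2 * z) * jTheta τ (3 * z) *
        jTheta τ (4 * z) ^ 2 * jTheta τ (7 * z)) =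
    dedekindEta τ ^ (-3 : ℤ) *
      (jTheta τ z ^ 3 * jTheta τ (2 * z) ^ 3 * jTheta τ (3 * z) *
        jTheta τ (5 * z) * jTheta τ (7 * z)) -
    dedekindEta τ ^ (-3 : ℤ) *
      (jTheta τ z ^ 5 * jTheta τ (2 * z) ^ 2 * jTheta τ (6 * z) * jTheta τ (7 * z)) := by
  linear_combination (dedekindEta τ ^ (-3 : ℤ) * jTheta τ z ^ 3 * jTheta τ (2 * z) *
    jTheta τ (7 * z)) * three_term hτ z
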